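/- Let y > 1 be fixed. For every fixed real s, h_n(s) → e^{−s²} as n → ∞, where h_n is defined via r(n), a(n), b_ν(n) as in the context. -/

import Mathlib

open Filter Topology

/-- `∑ k^m (-q)^k` (over `k ≥ 1`) is at most `6 q m!` in norm, because `k^m ≤ m! e^k`. -/
lemma norm_tsum_pow_mul_neg_pow_le (m : ℕ) {q : ℝ} (hq0 : 0 ≤ q) (hq : 6 * q ≤ 1) :
    ‖∑' k : ℕ, ((k + 1 : ℕ) : ℂ) ^ m * (-(q : ℂ)) ^ (k + 1)‖ ≤ 6 * q * m.factorial := by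
  have hs : HasSum (fun k : ℕ => (m.factorial : ℝ) * (3 * q) * (1 / 2 : ℝ) ^ k)
      ((m.factorial : ℝ) * (3 * q) * 2) := hasSum_geometric_two.mul_left _
  refine (tsum_of_norm_bounded hs fun k => ?_).trans_eq (by ring)
  have hpow : ((k + 1 : ℕ) : ℝ) ^ m ≤ m.factorial * 3 ^ (k + 1) := by
    have h1 := Real.pow_div_factorial_le_exp ((k + 1 : ℕ) : ℝ) (by positivity) m
    rw [div_le_iff₀ (by positivity)] at h1
    have h2 : Real.exp ((k + 1 : ℕ) : ℝ) ≤ 3 ^ (k + 1) := by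
      rw [← mul_one ((k + 1 : ℕ) : ℝ), Real.exp_nat_mul]
      gcongr
      linarith [Real.exp_one_lt_d9]
    calc ((k + 1 : ℕ) : ℝ) ^ m ≤ Real.exp ((k + 1 : ℕ) : ℝ) * m.factorial := h1
      _ ≤ 3 ^ (k + 1) * m.factorial := by gcongr
      _ = _ := mul_comm _ _
  rw [norm_mul, norm_pow, norm_pow, norm_neg, Complex.norm_natCast, Complex.norm_real,
    Real.norm_of_nonneg hq0]
  calc ((k + 1 : ℕ) : ℝ) ^ m * q ^ (k + 1)
      ≤ m.factorial * 3 ^ (k + 1) * q ^ (k + 1) := by gcongr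
    _ = m.factorial * (3 * q) * (3 * q) ^ k := by ring
    _ ≤ m.factorial * (3 * q) * (1 / 2) ^ k := by
      gcongr
      linarith

/-- A power series starting at degree three with coefficients bounded by `C` is at most
`2 C |x|^3` in norm for `|x| ≤ 1/2`. -/
lemma norm_tsum_mul_pow_add_three_le {c : ℕ → ℂ} {C x : ℝ} (hc : ∀ ν, ‖c ν‖ ≤ C)
    (hx : |x| ≤ 1 / 2) : ‖∑' ν : ℕ, c ν * (x : ℂ) ^ (ν + 3)‖ ≤ 2 * C * |x| ^ 3 := by
  have hC : 0 ≤ C := (norm_nonneg _).trans (hc 0)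
  have hs : HasSum (fun k : ℕ => C * |x| ^ 3 * (1 / 2 : ℝ) ^ k) (C * |x| ^ 3 * 2) :=
    hasSum_geometric_two.mul_left _
  refine (tsum_of_norm_bounded hs fun k => ?_).trans_eq (by ring)
  rw [norm_mul, norm_pow, Complex.norm_real, Real.norm_eq_abs]
  calc ‖c k‖ * |x| ^ (k + 3) ≤ C * |x| ^ (k + 3) := by gcongr; exact hc k
    _ = C * |x| ^ 3 * |x| ^ k := by ring
    _ ≤ _ := by gcongr

/-- Solutions `r n` of `t (e^t + w) = n c` tend to infinity with `n`. -/
lemma tendsto_atTop_of_mul_exp_add_eq {r : ℕ → ℝ} {w c : ℝ} (hw : 0 ≤ w) (hc : 0 < c)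
    (hr : ∀ n : ℕ, 0 < n → 0 < r n ∧ r n * (Real.exp (r n) + w) = n * c) :
    Tendsto r atTop atTop := by
  refine tendsto_atTop.2 fun M => ?_
  have ht : Tendsto (fun n : ℕ => (n : ℝ) * c) atTop atTop :=
    tendsto_natCast_atTop_atTop.atTop_mul_const hc
  filter_upwards [ht.eventually_gt_atTop (M * (Real.exp M + w)), eventually_gt_atTop 0]
    with n hn hn0
  obtain ⟨h0, h1⟩ := hr n hn0
  by_contra! hlt
  have hM : 0 ≤ M := (h0.trans hlt).le
  have : r n * (Real.exp (r n) + w) ≤ M * (Real.exp M + w) := by gcongr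
  linarith


/-- Pointwise convergence of `h_n`: for each fixed real `s`, `h_n(s) → e^{−s²}` as `n → ∞`. -/
theorem h_pointwise_limit (y : ℝ) (hy : 1 < y) (r a : ℕ → ℝ) (b : ℕ → ℕ → ℂ) (h : ℕ → ℝ → ℂ)
    (hr : ∀ n : ℕ, 0 < n →
      0 < r n ∧ r n * (Real.exp (r n) + Real.sqrt y) = n * Real.sqrt y * Real.log y)
    (ha : ∀ n : ℕ, a n = 1 / (2 * Real.log y) +
      n * Real.sqrt y * Real.exp (-(r n)) / (2 * (1 + Real.sqrt y * Real.exp (-(r n))) ^ 2))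
    (hb : ∀ ν n : ℕ, 3 ≤ ν → b ν n =
      (-(n : ℂ) * Complex.I ^ ν / (ν.factorial : ℂ)) *
        ∑' k : ℕ, ((k + 1 : ℕ) : ℂ) ^ (ν - 1) * (-(Real.sqrt y * Real.exp (-(r n))) : ℂ) ^ (k + 1))
    (hh : ∀ (n : ℕ) (s : ℝ), h n s =
      if s ∈ Set.Icc (-Real.sqrt (a n)) (Real.sqrt (a n)) then
        Complex.exp (-(s : ℂ) ^ 2 +
          ∑' ν : ℕ, b (ν + 3) n * ((s / Real.sqrt (a n) : ℝ) : ℂ) ^ (ν + 3))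
      else 0) :
    ∀ s : ℝ, Filter.Tendsto (fun n : ℕ => h n s) Filter.atTop
      (nhds (Complex.exp (-(s : ℂ) ^ 2))) := by
  intro s
  have hL : 0 < Real.log y := Real.log_pos hy
  have hw : 0 < Real.sqrt y := Real.sqrt_pos.2 (by linarith)
  have hrt : Tendsto r atTop atTop :=
    tendsto_atTop_of_mul_exp_add_eq hw.le (mul_pos hw hL) fun n hn => by
      rw [← mul_assoc]; exact hr n hn
  set q : ℕ → ℝ := fun n => Real.sqrt y * Real.exp (-(r n)) with hq
  have hq0 : ∀ n, 0 < q n := fun n => mul_pos hw (Real.exp_pos _)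
  have hqt : Tendsto q atTop (𝓝 0) := by
    simpa using (Real.tendsto_exp_neg_atTop_nhds_zero.comp hrt).const_mul (Real.sqrt y)
  have hq6 : ∀ᶠ n in atTop, 6 * q n ≤ 1 := by
    filter_upwards [hqt.eventually_le_const (show (0 : ℝ) < 1 / 6 by norm_num)] with n hn
    linarith
  have hqa : ∀ᶠ n in atTop, n * q n ≤ 8 * a n := by
    filter_upwards [hq6] with n hn
    have h1 : n * q n / 8 ≤ n * q n / (2 * (1 + q n) ^ 2) := by
      have := hq0 n
      gcongr
      nlinarith
    have h2 : a n = 1 / (2 * Real.log y) + n * q n / (2 * (1 + q n) ^ 2) := by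
      rw [ha n, hq, mul_assoc]
    have h3 : 0 < 1 / (2 * Real.log y) := by positivity
    linarith
  have hat : Tendsto a atTop atTop := by
    refine tendsto_atTop_mono' _ ?_ (hrt.atTop_div_const (show 0 < 8 * Real.log y by positivity))
    filter_upwards [hqa, eventually_gt_atTop 0] with n hn hn0
    obtain ⟨h0, h1⟩ := hr n hn0
    have h2 : r n * (1 + q n) = n * q n * Real.log y := by
      have h3 : Real.exp (r n) * Real.exp (-(r n)) = 1 := by rw [← Real.exp_add]; simp
      simp only [hq]
      linear_combination Real.exp (-(r n)) * h1 - r n * h3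
    rw [div_le_iff₀ (by positivity)]
    nlinarith [mul_pos h0 (hq0 n), mul_le_mul_of_nonneg_right hn hL.le]
  have hst : Tendsto (fun n => Real.sqrt (a n)) atTop atTop := Real.tendsto_sqrt_atTop.comp hat
  have hbn : ∀ᶠ n in atTop, ∀ ν, ‖b (ν + 3) n‖ ≤ 6 * (n * q n) := by
    filter_upwards [hq6] with n hn ν
    have h1 := norm_tsum_pow_mul_neg_pow_le (ν + 2) (hq0 n).le hn
    have h2 := hq0 n
    have h3 : ((ν + 2).factorial : ℝ) ≤ (ν + 3).factorial := by
      exact_mod_cast Nat.factorial_le (by omega)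
    have h4 : (0 : ℝ) < (ν + 3).factorial := by positivity
    rw [hb (ν + 3) n (by omega), norm_mul, norm_div, norm_mul, norm_neg, norm_pow, Complex.norm_I,
      one_pow, mul_one, Complex.norm_natCast, Complex.norm_natCast, show ν + 3 - 1 = ν + 2 by omega,
      ← Complex.ofReal_mul]
    calc (n : ℝ) / (ν + 3).factorial * _
        ≤ (n : ℝ) / (ν + 3).factorial * (6 * q n * (ν + 2).factorial) := by gcongr
      _ ≤ (n : ℝ) / (ν + 3).factorial * (6 * q n * (ν + 3).factorial) := by gcongr
      _ = 6 * (n * q n) := by field_simp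
  have hsum : Tendsto (fun n => ∑' ν : ℕ, b (ν + 3) n * ((s / Real.sqrt (a n) : ℝ) : ℂ) ^ (ν + 3))
      atTop (𝓝 0) := by
    refine squeeze_zero_norm' ?_ (hst.const_div_atTop (96 * |s| ^ 3))
    filter_upwards [hbn, hqa, hst.eventually_ge_atTop (2 * |s|), hst.eventually_gt_atTop 0]
      with n h1 h2 h3 h4
    have hx : |s / Real.sqrt (a n)| = |s| / Real.sqrt (a n) := by rw [abs_div, abs_of_pos h4]
    refine (norm_tsum_mul_pow_add_three_le h1 ?_).trans ?_
    · rw [hx, div_le_iff₀ h4]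
      linarith
    · have h5 : Real.sqrt (a n) ^ 2 = a n := Real.sq_sqrt (Real.sqrt_pos.1 h4).le
      calc 2 * (6 * (n * q n)) * |s / Real.sqrt (a n)| ^ 3
          ≤ 2 * (6 * (8 * Real.sqrt (a n) ^ 2)) * |s / Real.sqrt (a n)| ^ 3 := by
            rw [h5]; gcongr
        _ = 96 * |s| ^ 3 / Real.sqrt (a n) := by
            rw [hx]; field_simp; ring
  have hlim := (Complex.continuous_exp.tendsto _).comp (hsum.const_add (-(s : ℂ) ^ 2))
  rw [add_zero] at hlim
  refine hlim.congr' ?_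
  filter_upwards [hst.eventually_ge_atTop |s|] with n hn
  rw [hh, if_pos (Set.mem_Icc.2 (abs_le.1 hn)), Function.comp_apply]
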